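/- A function f : ℝ≥0 → ℝ≥0 is ultrametric preserving (i.e., for every ultrametric d on any space X, f ∘ d is again an ultrametric) if and only if f is monotone increasing and f⁻¹({0}) = {0}. -/

import Mathlib

open NNReal

/-- A function `f : ℝ≥0 → ℝ≥0` is ultrametric preserving iff it is monotone
increasing and `f⁻¹({0}) = {0}`. -/
theorem stmt_3 (f : ℝ≥0 → ℝ≥0) :
    (∀ (X : Type) (d : X → X → ℝ≥0),
        ((∀ x y : X, d x y = 0 ↔ x = y) ∧ (∀ x y : X, d x y = d y x) ∧
          (∀ x y z : X, d x y ≤ max (d x z) (d z y))) →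
        ((∀ x y : X, f (d x y) = 0 ↔ x = y) ∧ (∀ x y : X, f (d x y) = f (d y x)) ∧
          (∀ x y z : X, f (d x y) ≤ max (f (d x z)) (f (d z y))))) ↔
    (Monotone f ∧ ∀ r : ℝ≥0, f r = 0 ↔ r = 0) := by
  constructor
  · intro h
    classical
    obtain ⟨h1, _, h3⟩ := h ℝ≥0 (fun x y => if x = y then 0 else max x y) (by
      refine ⟨?_, ?_, ?_⟩
      · intro x y
        by_cases hxy : x = y
        · simp [hxy]
        · simp only [hxy, if_false, iff_false]
          intro h0
          apply hxy
          have hx : x ≤ 0 := h0 ▸ le_max_left x y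
          have hy : y ≤ 0 := h0 ▸ le_max_right x y
          rw [nonpos_iff_eq_zero] at hx hy
          rw [hx, hy]
      · intro x y
        simp only [eq_comm (a := x), max_comm x]
      · intro x y z
        by_cases hxy : x = y
        · simp [hxy]
        · by_cases hxz : x = z
          · subst hxz
            simp [hxy]
          · by_cases hzy : z = y
            · subst hzy
              simp [hxy]
            · simp only [hxy, hxz, hzy, if_false]
              exact max_le_max (le_max_left _ _) (le_max_right _ _))
    have hd : ∀ r : ℝ≥0, (if (0 : ℝ≥0) = r then 0 else max 0 r) = r := by
      intro r
      by_cases hr : 0 = r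
      · simp [hr]
      · simp [hr]
    refine ⟨?_, ?_⟩
    · intro a b hab
      rcases eq_or_lt_of_le hab with rfl | hlt
      · exact le_rfl
      · have h := h3 0 a b
        simp only [hd] at h
        rw [if_neg hlt.ne', max_eq_left hab, max_self] at h
        exact h
    · intro r
      have h := h1 0 r
      simp only [hd] at h
      rw [h, eq_comm]
  · rintro ⟨hm, h0⟩ X d ⟨h1, h2, h3⟩
    refine ⟨fun x y => (h0 _).trans (h1 x y), fun x y => by rw [h2], fun x y z => ?_⟩
    rw [← hm.map_max]
    exact hm (h3 x y z)
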